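/- For every n ≥ 1, the recursively defined family I_{2n} is a pattern basis of rank 2n: its 4^n elements are pairwise orthogonal pattern bit vectors of rank 2n (the pointwise XOR of any two distinct elements takes the value true at exactly 2^(2n-1) indices). -/

import Mathlib

/-- The product `p ⊙ q` of a pattern bit vector `p` of rank `n` with a pattern bit
vector `q` of rank `m`: `(p ⊙ q)(i * 2^m + j) = xor (p i) (q j)`. -/
def pbvProd {n m : ℕ} (p : Fin (2^n) → Bool) (q : Fin (2^m) → Bool) :
    Fin (2^(n+m)) → Bool :=
  fun k =>
    xor (p ⟨(k : ℕ) / 2^m, by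
      have hk : (k : ℕ) < 2^m * 2^n :=
        lt_of_lt_of_eq k.isLt (by rw [pow_add, Nat.mul_comm])
      exact Nat.div_lt_of_lt_mul hk⟩)
      (q ⟨(k : ℕ) % 2^m, Nat.mod_lt _ (by positivity)⟩)

/-- Two pattern bit vectors of rank `n` are orthogonal if their pointwise XOR equals
`true` at exactly `2^(n-1)` of the `2^n` indices. -/
def PBVOrthogonal {n : ℕ} (p q : Fin (2^n) → Bool) : Prop :=
  (Finset.univ.filter fun i => xor (p i) (q i) = true).card = 2^(n-1)

/-- The base family `I₂`: `p_k i = decide (i = k)` for `k ∈ Fin 4`. -/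
def I2base : Fin (2^2) → Fin (2^2) → Bool := fun k i => decide (i = k)

/-- The recursively defined family `I_{2n}`:
`I_{2(n+1)} (i * 4^n + j) = p_i ⊙ I_{2n} j`. -/
def Ifam : (n : ℕ) → Fin (2^(2*n)) → Fin (2^(2*n)) → Bool
  | 0 => fun _ _ => false
  | n+1 => fun k z =>
      pbvProd (n := 2) (m := 2*n)
        (I2base ⟨(k : ℕ) / 2^(2*n), by
          have hk : (k : ℕ) < 2^(2*n) * 2^2 :=
            lt_of_lt_of_eq k.isLt
              (by rw [show 2*(n+1) = 2*n + 2 from by omega, pow_add])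
          exact Nat.div_lt_of_lt_mul hk⟩)
        (Ifam n ⟨(k : ℕ) % 2^(2*n), Nat.mod_lt _ (by positivity)⟩)
        (Fin.cast (congrArg (fun t => 2^t) (by omega : 2*(n+1) = 2 + 2*n)) z)

/-- The correlation of two Boolean vectors: agreements minus disagreements. -/
def boolCorr {ι : Type*} [Fintype ι] (p q : ι → Bool) : ℤ :=
  ∑ i, if xor (p i) (q i) = true then -1 else 1

lemma boolCorr_eq {ι : Type*} [Fintype ι] (p q : ι → Bool) :
    boolCorr p q =
      Fintype.card ι - 2 * (Finset.univ.filter fun i => xor (p i) (q i) = true).card := by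
  have h (i : ι) : (if xor (p i) (q i) = true then (-1 : ℤ) else 1) =
      1 - 2 * (if xor (p i) (q i) = true then 1 else 0) := by
    split_ifs <;> rfl
  simp only [boolCorr, h, Finset.sum_sub_distrib, ← Finset.mul_sum, Finset.sum_boole]
  simp

lemma pbvOrthogonal_of_boolCorr_eq_zero {n : ℕ} (hn : 1 ≤ n) {p q : Fin (2^n) → Bool}
    (h : boolCorr p q = 0) : PBVOrthogonal p q := by
  obtain ⟨m, rfl⟩ := Nat.exists_eq_add_of_le' hn
  rw [boolCorr_eq, Fintype.card_fin] at h
  unfold PBVOrthogonal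
  push_cast [pow_succ] at h
  zify
  simp only [Nat.add_sub_cancel]
  linarith

lemma boolCorr_comp_equiv {ι κ : Type*} [Fintype ι] [Fintype κ] (e : ι ≃ κ) (p q : κ → Bool) :
    boolCorr (p ∘ e) (q ∘ e) = boolCorr p q :=
  e.sum_comp fun i => if xor (p i) (q i) = true then (-1 : ℤ) else 1

lemma boolCorr_prod_xor {ι κ : Type*} [Fintype ι] [Fintype κ] (p p' : ι → Bool)
    (q q' : κ → Bool) :
    boolCorr (fun x : ι × κ => xor (p x.1) (q x.2)) (fun x => xor (p' x.1) (q' x.2)) =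
      boolCorr p p' * boolCorr q q' := by
  simp only [boolCorr, Finset.sum_mul_sum, Fintype.sum_prod_type]
  refine Finset.sum_congr rfl fun i _ => Finset.sum_congr rfl fun j _ => ?_
  have h : ∀ a b c d : Bool, (if xor (xor a c) (xor b d) = true then (-1 : ℤ) else 1) =
      (if xor a b = true then -1 else 1) * if xor c d = true then -1 else 1 := by decide
  exact h _ _ _ _

lemma boolCorr_pbvProd {n m : ℕ} (p p' : Fin (2^n) → Bool) (q q' : Fin (2^m) → Bool) :
    boolCorr (pbvProd p q) (pbvProd p' q') = boolCorr p p' * boolCorr q q' := by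
  rw [← boolCorr_prod_xor, ← boolCorr_comp_equiv
    ((finCongr (pow_add 2 n m)).trans finProdFinEquiv.symm)]
  rfl

lemma boolCorr_I2base : ∀ a b : Fin (2^2), a ≠ b → boolCorr (I2base a) (I2base b) = 0 := by
  decide

lemma boolCorr_Ifam (n : ℕ) :
    ∀ k l : Fin (2^(2*n)), k ≠ l → boolCorr (Ifam n k) (Ifam n l) = 0 := by
  induction n with
  | zero => exact fun k l h => absurd (Subsingleton.elim (α := Fin 1) k l) h
  | succ n ih =>
    intro k l hkl
    refine (boolCorr_comp_equiv (finCongr (congrArg (2 ^ ·) (by omega : 2*(n+1) = 2 + 2*n)))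
      _ _).trans ((boolCorr_pbvProd _ _ _ _).trans ?_)
    by_cases hdiv : (k : ℕ) / 2^(2*n) = l / 2^(2*n)
    · refine mul_eq_zero_of_right _ (ih _ _ fun hmod => hkl (Fin.ext ?_))
      rw [← Nat.div_add_mod (k : ℕ) (2^(2*n)), ← Nat.div_add_mod (l : ℕ) (2^(2*n)), hdiv,
        Fin.mk.inj hmod]
    · exact mul_eq_zero_of_left (boolCorr_I2base _ _ fun h => hdiv (Fin.mk.inj h)) _

/-- For every `n ≥ 1`, the recursively defined family `I_{2n}` is a
pattern basis of rank `2n`: its elements are pairwise orthogonal. -/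
theorem Ifam_pattern_basis (n : ℕ) (hn : 1 ≤ n) :
    ∀ k l : Fin (2^(2*n)), k ≠ l → PBVOrthogonal (Ifam n k) (Ifam n l) := by
  exact fun k l hkl =>
    pbvOrthogonal_of_boolCorr_eq_zero (by omega) (boolCorr_Ifam n k l hkl)
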